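/- Let D be a commutative Dedekind domain, σ ≠ 1 an automorphism, δ ≠ 0 a σ-derivation, R = D[x; σ, δ]. If 𝔭 is a minimal (σ, δ)-prime ideal of D and P = 𝔭[x; σ, δ], then P is a minimal prime ideal of R. -/

import Mathlib

open Polynomial Finset

/-- An Ore extension `R = D[x; σ, δ]`: a ring `R` containing (an image of) `D`,
with an element `x` satisfying `x·a = σ(a)x + δ(a)`, which is a free left
`D`-module with basis `1, x, x², …` (every element has a unique polynomial
representation with left-hand coefficients). -/
structure OreData (D : Type*) (R : Type*) [Ring D] [Ring R]
    (σ : D →+* D) (δ : D → D) where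
  i : D →+* R
  x : R
  comm : ∀ a : D, x * i a = i (σ a) * x + i (δ a)
  repr : ∀ f : R, ∃! g : Polynomial D, f = g.sum fun k a => i a * x ^ k

/-- `𝔭[x; σ, δ] = 𝔭R`: the set of elements of `R` all of whose coefficients lie in `𝔭`. -/
def OreData.pSet {D R : Type*} [Ring D] [Ring R] {σ : D →+* D} {δ : D → D}
    (O : OreData D R σ δ) (𝔭 : Ideal D) : Set R :=
  {f | ∃ g : Polynomial D, (∀ k, g.coeff k ∈ 𝔭) ∧ f = g.sum fun k a => O.i a * O.x ^ k}

/-- A `(σ, δ)`-ideal: an ideal stable under `σ` and `δ`. -/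
def SDIdeal {D : Type*} [CommRing D] (σ δ : D → D) (I : Ideal D) : Prop :=
  (∀ a ∈ I, σ a ∈ I) ∧ (∀ a ∈ I, δ a ∈ I)

/-- A `(σ, δ)`-prime ideal: a proper `(σ, δ)`-ideal `I` such that `JK ⊆ I` for
`(σ, δ)`-ideals `J, K` implies `J ⊆ I` or `K ⊆ I`. -/
def SDPrime {D : Type*} [CommRing D] (σ δ : D → D) (I : Ideal D) : Prop :=
  I ≠ ⊤ ∧ SDIdeal σ δ I ∧
    ∀ J K : Ideal D, SDIdeal σ δ J → SDIdeal σ δ K → J * K ≤ I → J ≤ I ∨ K ≤ I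

/-- Minimal among nonzero `(σ, δ)`-prime ideals. -/
def MinSDPrime {D : Type*} [CommRing D] (σ δ : D → D) (I : Ideal D) : Prop :=
  I ≠ ⊥ ∧ SDPrime σ δ I ∧ ∀ J : Ideal D, SDPrime σ δ J → J ≠ ⊥ → J ≤ I → J = I

/-- A (two-sided) ideal of a possibly noncommutative ring, as a set. -/
def IsTwoSidedIdealSet {R : Type*} [Ring R] (P : Set R) : Prop :=
  0 ∈ P ∧ (∀ a b : R, a ∈ P → b ∈ P → a + b ∈ P) ∧
    (∀ r a : R, a ∈ P → r * a ∈ P) ∧ (∀ r a : R, a ∈ P → a * r ∈ P)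

/-- A prime (two-sided) ideal of a possibly noncommutative ring. -/
def IsPrimeTS {R : Type*} [Ring R] (P : Set R) : Prop :=
  IsTwoSidedIdealSet P ∧ P ≠ Set.univ ∧
    ∀ a b : R, (∀ r : R, a * r * b ∈ P) → a ∈ P ∨ b ∈ P

/-- Minimal among nonzero prime (two-sided) ideals of `R`. -/
def MinimalPrimeTS {R : Type*} [Ring R] (P : Set R) : Prop :=
  IsPrimeTS P ∧ P ≠ {0} ∧ ∀ Q : Set R, IsPrimeTS Q → Q ≠ {0} → Q ⊆ P → Q = P

set_option linter.all false

namespace OreData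

section basic

variable {D R : Type*} [CommRing D] [Ring R] {s : D →+* D} {δ : D → D}

/-- Evaluation of a polynomial with left coefficients. -/
noncomputable def ev (O : OreData D R s δ) (g : D[X]) : R := g.sum fun k a => O.i a * O.x ^ k

/-- The polynomial of an element. -/
noncomputable def ph (O : OreData D R s δ) (f : R) : D[X] := (O.repr f).choose

/-- The coefficients of an element. -/
noncomputable def cf (O : OreData D R s δ) (k : ℕ) (f : R) : D := (O.ph f).coeff k

variable (O : OreData D R s δ)

lemma ev_ph (f : R) : O.ev (O.ph f) = f := ((O.repr f).choose_spec.1).symm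

lemma ph_ev (g : D[X]) : O.ph (O.ev g) = g :=
  ((O.repr (O.ev g)).choose_spec.2 g rfl).symm

lemma ev_add (g h : D[X]) : O.ev (g + h) = O.ev g + O.ev h := by
  unfold ev
  apply Polynomial.sum_add_index
  · intro k; simp
  · intro k a b; simp [add_mul]

lemma ev_monomial (n : ℕ) (a : D) : O.ev (monomial n a) = O.i a * O.x ^ n := by
  unfold ev
  apply Polynomial.sum_monomial_index
  simp

lemma ph_add (f g : R) : O.ph (f + g) = O.ph f + O.ph g := by
  conv_lhs => rw [← O.ev_ph f, ← O.ev_ph g, ← ev_add, ph_ev]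

lemma cf_add (k : ℕ) (f g : R) : O.cf k (f + g) = O.cf k f + O.cf k g := by
  simp [cf, ph_add]

/-- Coefficient as an additive map. -/
noncomputable def cfHom (k : ℕ) : R →+ D := AddMonoidHom.mk' (O.cf k) (O.cf_add k)

lemma cf_zero (k : ℕ) : O.cf k 0 = 0 := map_zero (O.cfHom k)

lemma cf_sub (k : ℕ) (f g : R) : O.cf k (f - g) = O.cf k f - O.cf k g := map_sub (O.cfHom k) f g

lemma cf_sum {ι : Type*} (t : Finset ι) (k : ℕ) (f : ι → R) :
    O.cf k (∑ j ∈ t, f j) = ∑ j ∈ t, O.cf k (f j) := map_sum (O.cfHom k) f t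

lemma cf_ext {f g : R} (h : ∀ k, O.cf k f = O.cf k g) : f = g := by
  rw [← O.ev_ph f, ← O.ev_ph g]
  congr 1
  ext k
  exact h k

lemma cf_mono (k n : ℕ) (a : D) : O.cf k (O.i a * O.x ^ n) = if n = k then a else 0 := by
  rw [← ev_monomial, cf, ph_ev, coeff_monomial]

/-- Induction principle. -/
lemma ind {p : R → Prop} (hadd : ∀ f g, p f → p g → p (f + g))
    (hm : ∀ (n : ℕ) (a : D), p (O.i a * O.x ^ n)) (f : R) : p f := by
  rw [← O.ev_ph f]
  induction O.ph f using Polynomial.induction_on' with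
  | add g h hg hh => rw [ev_add]; exact hadd _ _ hg hh
  | monomial n a => rw [ev_monomial]; exact hm n a

lemma cf_imul (k : ℕ) (a : D) (f : R) : O.cf k (O.i a * f) = a * O.cf k f := by
  induction f using O.ind with
  | hadd f g hf hg => rw [mul_add, cf_add, cf_add, hf, hg, mul_add]
  | hm n b => rw [← mul_assoc, ← map_mul, cf_mono, cf_mono]; split_ifs <;> simp

lemma cf_mulx_succ (k : ℕ) (f : R) : O.cf (k+1) (f * O.x) = O.cf k f := by
  induction f using O.ind with
  | hadd f g hf hg => rw [add_mul, cf_add, cf_add, hf, hg]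
  | hm n b => rw [mul_assoc, ← pow_succ, cf_mono, cf_mono]; simp

lemma cf_mulx_zero (f : R) : O.cf 0 (f * O.x) = 0 := by
  induction f using O.ind with
  | hadd f g hf hg => rw [add_mul, cf_add, hf, hg, add_zero]
  | hm n b => rw [mul_assoc, ← pow_succ, cf_mono]; simp

lemma delta_zero (hadd : ∀ a b : D, δ (a + b) = δ a + δ b) : δ 0 = 0 := by
  have := hadd 0 0
  simpa using this

lemma x_mono (n : ℕ) (b : D) : O.x * (O.i b * O.x ^ n) =
    O.i (s b) * O.x ^ (n+1) + O.i (δ b) * O.x ^ n := by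
  rw [← mul_assoc, O.comm, add_mul, mul_assoc, ← pow_succ']

lemma cf_xmul_succ (hadd : ∀ a b : D, δ (a + b) = δ a + δ b) (k : ℕ) (f : R) :
    O.cf (k+1) (O.x * f) = s (O.cf k f) + δ (O.cf (k+1) f) := by
  induction f using O.ind with
  | hadd f g hf hg => rw [mul_add, cf_add, cf_add, cf_add, hf, hg, hadd, map_add]; ring
  | hm n b =>
    rw [x_mono, cf_add, cf_mono, cf_mono, cf_mono, cf_mono]
    have := delta_zero hadd
    split_ifs <;> simp_all

lemma cf_xmul_zero (hadd : ∀ a b : D, δ (a + b) = δ a + δ b) (f : R) :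
    O.cf 0 (O.x * f) = δ (O.cf 0 f) := by
  induction f using O.ind with
  | hadd f g hf hg => rw [mul_add, cf_add, cf_add, hf, hg, hadd]
  | hm n b =>
    rw [x_mono, cf_add, cf_mono, cf_mono, cf_mono]
    have := delta_zero hadd
    split_ifs <;> simp_all

lemma eq_sum (f : R) : f = ∑ k ∈ (O.ph f).support, O.i (O.cf k f) * O.x ^ k := by
  conv_lhs => rw [← O.ev_ph f]
  rfl

lemma mul_eq_sum (f g : R) :
    f * g = ∑ k ∈ (O.ph f).support, O.i (O.cf k f) * (O.x ^ k * g) := by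
  conv_lhs => rw [O.eq_sum f, Finset.sum_mul]
  simp only [mul_assoc]

lemma mem_pSet {I : Ideal D} {f : R} : f ∈ O.pSet I ↔ ∀ k, O.cf k f ∈ I := by
  constructor
  · rintro ⟨g, hg, rfl⟩ k
    have : O.cf k (O.ev g) = g.coeff k := by rw [cf, ph_ev]
    change O.cf k (O.ev g) ∈ I
    rw [this]; exact hg k
  · intro h
    exact ⟨O.ph f, h, (O.ev_ph f).symm⟩

lemma exists_bound (f : R) : ∃ n, ∀ k, n < k → O.cf k f = 0 :=
  ⟨(O.ph f).natDegree, fun _ hk => coeff_eq_zero_of_natDegree_lt hk⟩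

/-- Elements of degree at most `n` modulo `I`. -/
def dg (I : Ideal D) (n : ℕ) (f : R) : Prop := ∀ k, n < k → O.cf k f ∈ I

lemma xpow_dg (hadd : ∀ a b : D, δ (a + b) = δ a + δ b) {I : Ideal D}
    (hs : ∀ a ∈ I, s a ∈ I) (hd : ∀ a ∈ I, δ a ∈ I) {m : ℕ} {g : R} (hg : O.dg I m g) (k : ℕ) :
    O.dg I (m + k) (O.x ^ k * g) ∧ O.cf (m + k) (O.x ^ k * g) - s^[k] (O.cf m g) ∈ I := by
  induction k with
  | zero => simpa using hg
  | succ k ih =>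
    obtain ⟨h1, h2⟩ := ih
    rw [pow_succ', mul_assoc]
    constructor
    · intro j hj
      obtain ⟨j, rfl⟩ : ∃ j', j = j' + 1 := ⟨j - 1, by omega⟩
      rw [cf_xmul_succ _ hadd]
      exact I.add_mem (hs _ (h1 _ (by omega))) (hd _ (h1 _ (by omega)))
    · rw [← add_assoc, cf_xmul_succ _ hadd, Function.iterate_succ_apply']
      have e1 := hs _ h2
      have e2 := hd _ (h1 (m+k+1) (by omega))
      rw [map_sub] at e1
      have := I.add_mem e1 e2
      convert this using 1
      ring

lemma mul_top (hadd : ∀ a b : D, δ (a + b) = δ a + δ b) {I : Ideal D}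
    (hs : ∀ a ∈ I, s a ∈ I) (hd : ∀ a ∈ I, δ a ∈ I) {n m : ℕ} {f g : R}
    (hf : O.dg I n f) (hg : O.dg I m g) (h : f * g ∈ O.pSet I) :
    O.cf n f * s^[n] (O.cf m g) ∈ I := by
  have h1 := (O.mem_pSet.1 h) (m + n)
  rw [O.mul_eq_sum, cf_sum] at h1
  simp only [cf_imul] at h1
  have key : ∀ k, k ≠ n → O.cf k f * O.cf (m+n) (O.x ^ k * g) ∈ I := by
    intro k hk
    rcases lt_or_gt_of_ne hk with h | h
    · exact I.mul_mem_left _ ((O.xpow_dg hadd hs hd hg k).1 _ (by omega))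
    · exact I.mul_mem_right _ (hf k h)
  have h2 : O.cf n f * O.cf (m+n) (O.x ^ n * g) ∈ I := by
    by_cases hn : n ∈ (O.ph f).support
    · rw [← Finset.add_sum_erase _ _ hn] at h1
      refine (I.add_mem_iff_left ?_).1 h1
      exact I.sum_mem fun k hk => key k (Finset.ne_of_mem_erase hk)
    · have : O.cf n f = 0 := by simpa [cf] using hn
      rw [this, zero_mul]; exact I.zero_mem
  have h3 := I.mul_mem_left (O.cf n f) (O.xpow_dg hadd hs hd hg n).2
  have := I.sub_mem h2 h3
  convert this using 1
  ring

lemma pSet_ideal (hadd : ∀ a b : D, δ (a + b) = δ a + δ b) {I : Ideal D}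
    (hs : ∀ a ∈ I, s a ∈ I) (hd : ∀ a ∈ I, δ a ∈ I) : IsTwoSidedIdealSet (O.pSet I) := by
  refine ⟨?_, ?_, ?_, ?_⟩
  · rw [mem_pSet]; intro k; rw [cf_zero]; exact I.zero_mem
  · intro a b ha hb
    rw [mem_pSet] at *
    intro k; rw [cf_add]; exact I.add_mem (ha k) (hb k)
  · intro r a ha
    rw [mem_pSet] at *
    have hx : ∀ n k, O.cf k (O.x ^ n * a) ∈ I := by
      intro n
      induction n with
      | zero => simpa using ha
      | succ n ih =>
        intro k
        rw [pow_succ', mul_assoc]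
        cases k with
        | zero => rw [cf_xmul_zero _ hadd]; exact hd _ (ih _)
        | succ k => rw [cf_xmul_succ _ hadd]; exact I.add_mem (hs _ (ih _)) (hd _ (ih _))
    intro k
    rw [O.mul_eq_sum, cf_sum]
    refine I.sum_mem fun j _ => ?_
    rw [cf_imul]; exact I.mul_mem_left _ (hx _ _)
  · intro r a ha
    rw [mem_pSet] at *
    intro k
    rw [O.mul_eq_sum, cf_sum]
    refine I.sum_mem fun j _ => ?_
    rw [cf_imul]; exact I.mul_mem_right _ (ha _)

lemma ts_sum {Q : Set R} (hQ : IsTwoSidedIdealSet Q) {ι : Type*} (t : Finset ι) (f : ι → R)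
    (h : ∀ j ∈ t, f j ∈ Q) : ∑ j ∈ t, f j ∈ Q :=
  Finset.sum_induction _ (· ∈ Q) (fun a b => hQ.2.1 a b) hQ.1 h

end basic

end OreData

section dedekind

variable {D : Type*} [CommRing D] [IsDomain D] [IsDedekindDomain D]

lemma symm_mem_of_stable (σ : D ≃+* D) {I : Ideal D} (h : ∀ a ∈ I, σ a ∈ I) {b : D} (hb : b ∈ I) :
    σ.symm b ∈ I := by
  have hit : ∀ (n : ℕ), ∀ a ∈ I, σ^[n] a ∈ I := by
    intro n
    induction n with
    | zero => simp
    | succ n ih => intro a ha; rw [Function.iterate_succ_apply]; exact ih _ (h a ha)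
  have hadd : ∀ (n : ℕ) (a b : D), σ^[n] (a + b) = σ^[n] a + σ^[n] b := fun n a b =>
    iterate_map_add σ n a b
  have hmul : ∀ (n : ℕ) (a b : D), σ^[n] (a * b) = σ^[n] a * σ^[n] b := fun n a b =>
    iterate_map_mul σ n a b
  have hz : ∀ (n : ℕ), σ^[n] 0 = 0 := fun n => iterate_map_zero σ n
  let C : ℕ →o Ideal D :=
    { toFun := fun n =>
        { carrier := {a | σ^[n] a ∈ I}
          add_mem' := by
            intro a b ha hb
            simp only [Set.mem_setOf_eq, hadd] at *
            exact I.add_mem ha hb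
          zero_mem' := by simp only [Set.mem_setOf_eq, hz]; exact I.zero_mem
          smul_mem' := by
            intro c a ha
            simp only [Set.mem_setOf_eq, smul_eq_mul, hmul] at *
            exact I.mul_mem_left _ ha }
      monotone' := by
        refine monotone_nat_of_le_succ ?_
        intro n a ha
        change σ^[n+1] a ∈ I
        rw [Function.iterate_succ_apply']
        exact h _ ha }
  obtain ⟨N, hN⟩ := monotone_stabilizes_iff_noetherian.2 (inferInstance : IsNoetherian D D) C
  have hs : σ^[N] (σ.symm^[N] (σ.symm b)) = σ.symm b :=
    Function.RightInverse.iterate (f := σ) (g := σ.symm) (fun a => by simp) N _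
  have h1 : σ.symm^[N] (σ.symm b) ∈ C (N+1) := by
    change σ^[N+1] _ ∈ I
    rw [Function.iterate_succ_apply', hs]
    simpa using hb
  rw [← hN (N+1) (by omega)] at h1
  change σ^[N] _ ∈ I at h1
  rwa [hs] at h1

/-- If `X` is a `(σ,δ)`-ideal not inside the `(σ,δ)`-prime `𝔭`, then `cX ⊆ 𝔭` forces `c ∈ 𝔭`. -/
lemma colon_le {σ : D ≃+* D} {δ : D → D}
    (hleib : ∀ a b : D, δ (a * b) = σ a * δ b + δ a * b)
    (hadd : ∀ a b : D, δ (a + b) = δ a + δ b)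
    {p X : Ideal D} (hp : SDPrime σ δ p) (hX : SDIdeal σ δ X) (hXp : ¬ X ≤ p)
    {c : D} (hc : ∀ b ∈ X, c * b ∈ p) : c ∈ p := by
  let Y : Ideal D :=
    { carrier := {c | ∀ b ∈ X, c * b ∈ p}
      add_mem' := by
        intro a b ha hb d hd
        rw [add_mul]; exact p.add_mem (ha d hd) (hb d hd)
      zero_mem' := by intro d _; simp
      smul_mem' := by
        intro r a ha d hd
        rw [smul_eq_mul, mul_assoc]; exact p.mul_mem_left _ (ha d hd) }
  have hY : SDIdeal σ δ Y := by
    constructor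
    · intro a ha b hb
      have := hp.2.1.1 _ (ha _ (symm_mem_of_stable σ hX.1 hb))
      simpa using this
    · intro a ha b hb
      have hb' := symm_mem_of_stable σ hX.1 hb
      have h1 := hp.2.1.2 _ (ha _ hb')
      rw [mul_comm, hleib] at h1
      have h2 := ha _ (hX.2 _ hb')
      rw [mul_comm] at h2
      have := p.sub_mem h1 h2
      simpa [mul_comm] using this
  have hle : X * Y ≤ p := by
    rw [Ideal.mul_le]
    intro a ha b hb
    rw [mul_comm]; exact hb a ha
  rcases hp.2.2 X Y hX hY hle with h | h
  · exact absurd h hXp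
  · exact h hc

/-- Dichotomy: either every `σ`-ideal above `p` is `δ`-stable, or every ideal above `p`
is `σ`-stable. -/
lemma dichotomy {σ : D ≃+* D} {δ : D → D}
    (hleib : ∀ a b : D, δ (a * b) = σ a * δ b + δ a * b)
    (hadd : ∀ a b : D, δ (a + b) = δ a + δ b)
    {p : Ideal D} (hp0 : p ≠ ⊥) (hp : SDPrime σ δ p) :
    (∀ L : Ideal D, p ≤ L → (∀ a ∈ L, σ a ∈ L) → ∀ a ∈ L, δ a ∈ L) ∨
    (∀ L : Ideal D, p ≤ L → ∀ a ∈ L, σ a ∈ L) := by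
  let c : Ideal D := Ideal.span (Set.range fun a => a - σ a)
  by_cases h : c ⊔ p = ⊤
  · left
    intro L hL hs b hb
    let Y : Ideal D := Submodule.comap (LinearMap.mulLeft D (δ b)) L
    have h1 : c ≤ Y := by
      rw [Ideal.span_le]
      rintro _ ⟨a, rfl⟩
      change δ b * (a - σ a) ∈ L
      have e1 := hleib a b
      have e2 := hleib b a
      rw [mul_comm b a] at e2
      have e3 : δ b * (a - σ a) = δ a * (b - σ b) := by linear_combination e1 - e2
      rw [e3]
      exact L.mul_mem_left _ (L.sub_mem hb (hs b hb))
    have h2 : p ≤ Y := fun a ha => L.mul_mem_left _ (hL ha)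
    have h3 : (1 : D) ∈ Y := (sup_le h1 h2) (by rw [h]; trivial)
    have h4 : δ b * 1 ∈ L := h3
    simpa using h4
  · right
    obtain ⟨q, hq, hle⟩ := Ideal.exists_le_maximal _ h
    have hcq : ∀ a, a - σ a ∈ q := fun a =>
      hle (Ideal.mem_sup_left (Ideal.subset_span ⟨a, rfl⟩))
    have hpq : p ≤ q := le_trans le_sup_right hle
    have hqs : ∀ a, σ a ∈ q ↔ a ∈ q := by
      intro a
      constructor
      · intro h; have := q.add_mem (hcq a) h; simpa using this
      · intro h; have := q.sub_mem h (hcq a); simpa using this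
    have hqpr := hq.isPrime
    have hq0 : q ≠ ⊥ := fun h0 => hp0 (le_bot_iff.1 (h0 ▸ hpq))
    -- the q-saturation of p
    let X : Ideal D :=
      { carrier := {a | ∃ t, t ∉ q ∧ t * a ∈ p}
        add_mem' := by
          rintro a b ⟨t, ht, hta⟩ ⟨u, hu, hub⟩
          refine ⟨t * u, fun h => (hqpr.mem_or_mem h).elim ht hu, ?_⟩
          have := p.add_mem (p.mul_mem_left u hta) (p.mul_mem_left t hub)
          convert this using 1; ring
        zero_mem' := ⟨1, fun h => hqpr.ne_top ((Ideal.eq_top_iff_one _).2 h), by simp⟩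
        smul_mem' := by
          rintro r a ⟨t, ht, hta⟩
          refine ⟨t, ht, ?_⟩
          have := p.mul_mem_left r hta
          convert this using 1; rw [smul_eq_mul]; ring }
    have hX : SDIdeal σ δ X := by
      constructor
      · rintro a ⟨t, ht, hta⟩
        refine ⟨σ t, fun h => ht ((hqs t).1 h), ?_⟩
        rw [← map_mul]; exact hp.2.1.1 _ hta
      · rintro a ⟨t, ht, hta⟩
        refine ⟨t * σ t, fun h => (hqpr.mem_or_mem h).elim ht fun h => ht ((hqs t).1 h), ?_⟩
        have h1 := hp.2.1.2 _ hta
        rw [hleib] at h1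
        have := p.sub_mem (p.mul_mem_left t h1) (p.mul_mem_left (δ t) hta)
        convert this using 1; ring
    have hqprime : Prime q := Ideal.prime_of_isPrime hq0 hqpr
    have hfin : FiniteMultiplicity q p :=
      FiniteMultiplicity.of_prime_left hqprime hp0
    obtain ⟨e, I, hI, hIq⟩ : ∃ (e : ℕ) (I : Ideal D), p = q ^ e * I ∧ ¬ q ∣ I :=
      ⟨multiplicity q p, hfin.exists_eq_pow_mul_and_not_dvd⟩
    have hIq' : ¬ I ≤ q := fun h => hIq (Ideal.dvd_iff_le.2 h)
    obtain ⟨t, htI, htq⟩ := SetLike.not_le_iff_exists.1 hIq'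
    have hsub : ∀ a ∈ q ^ e, t * a ∈ p := by
      intro a ha
      rw [hI, mul_comm t a]; exact Ideal.mul_mem_mul ha htI
    -- X = q ^ e
    have hXq : X ≤ q ^ e := by
      rintro a ⟨u, hu, hua⟩
      have h1 : u * a ∈ q ^ e := by
        rw [hI] at hua; exact Ideal.mul_le_left hua
      have h2 : q ^ e ∣ Ideal.span {u} * Ideal.span {a} := by
        rw [Ideal.span_singleton_mul_span_singleton, Ideal.dvd_span_singleton]; exact h1
      have h3 : ¬ q ∣ Ideal.span {u} := by rwa [Ideal.dvd_span_singleton]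
      have := hqprime.pow_dvd_of_dvd_mul_left e h3 h2
      rwa [Ideal.dvd_span_singleton] at this
    have hXp : X ≤ p := by
      by_contra hcon
      exact htq (hpq (colon_le hleib hadd hp hX hcon (fun b hb => hsub b (hXq hb))))
    have hpe : p = q ^ e := by
      apply le_antisymm
      · rw [hI]; exact Ideal.mul_le_left
      · intro a ha; exact hXp ⟨t, htq, hsub a ha⟩
    intro L hL a ha
    rw [hpe] at hL
    obtain ⟨j, _, hj⟩ := (dvd_prime_pow hqprime e).1 (Ideal.dvd_iff_le.2 hL)
    rw [associated_iff_eq] at hj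
    have h1 : Ideal.map (σ : D →+* D) q ≤ q := by
      rw [Ideal.map_le_iff_le_comap]
      intro b hb
      exact (hqs b).2 hb
    have h2 : Ideal.map (σ : D →+* D) (q ^ j) ≤ q ^ j := by
      rw [Ideal.map_pow]; exact Ideal.pow_right_mono h1 j
    rw [hj] at ha ⊢
    exact h2 (Ideal.mem_map_of_mem (σ : D →+* D) ha)

end dedekind

section main

variable {D R : Type*} [CommRing D] [IsDomain D] [IsDedekindDomain D] [Ring R]

open OreData

/-- Leading coefficients (modulo `p`) in degree `m` of the elements of `J`. -/
def leadI {s : D →+* D} {δ : D → D} (O : OreData D R s δ) (p : Ideal D) {J : Set R}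
    (hJ : IsTwoSidedIdealSet J) (m : ℕ) : Ideal D where
  carrier := {b | ∃ g ∈ J, O.dg p m g ∧ O.cf m g = b}
  add_mem' := by
    rintro _ _ ⟨g, hg, hgd, rfl⟩ ⟨h, hh, hhd, rfl⟩
    refine ⟨g + h, hJ.2.1 _ _ hg hh, ?_, O.cf_add _ _ _⟩
    intro k hk; rw [O.cf_add]; exact p.add_mem (hgd k hk) (hhd k hk)
  zero_mem' := ⟨0, hJ.1, fun k _ => by rw [O.cf_zero]; exact p.zero_mem, O.cf_zero _⟩
  smul_mem' := by
    rintro c _ ⟨g, hg, hgd, rfl⟩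
    refine ⟨O.i c * g, hJ.2.2.1 _ _ hg, ?_, O.cf_imul _ _ _⟩
    intro k hk; rw [O.cf_imul]; exact p.mul_mem_left _ (hgd k hk)

lemma ts_sub {J : Set R} (hJ : IsTwoSidedIdealSet J) {a b : R} (ha : a ∈ J) (hb : b ∈ J) :
    a - b ∈ J := by
  have := hJ.2.1 _ _ ha (hJ.2.2.1 (-1) _ hb)
  simpa [sub_eq_add_neg] using this

/-- An ideal of `D`, consisting of leading coefficients of elements of `J`. -/
lemma exists_lead {σ : D ≃+* D} {δ : D → D}
    (hleib : ∀ a b : D, δ (a * b) = σ a * δ b + δ a * b)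
    (hadd : ∀ a b : D, δ (a + b) = δ a + δ b)
    (O : OreData D R (σ : D →+* D) δ)
    {p : Ideal D} (hp0 : p ≠ ⊥) (hp : SDPrime σ δ p) {J : Set R}
    (hJ : IsTwoSidedIdealSet J) (hPJ : O.pSet p ⊆ J) (hne : ¬ J ⊆ O.pSet p) :
    ∃ X : Ideal D, SDIdeal σ δ X ∧ ¬ X ≤ p ∧ ∀ b ∈ X, ∃ m, b ∈ leadI O p hJ m := by
  classical
  have hs : ∀ a ∈ p, (σ : D →+* D) a ∈ p := hp.2.1.1
  have hd : ∀ a ∈ p, δ a ∈ p := hp.2.1.2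
  have hpL : ∀ m, p ≤ leadI O p hJ m := by
    intro m a ha
    refine ⟨O.i a * O.x ^ m, hPJ ?_, ?_, ?_⟩
    · rw [O.mem_pSet]; intro k; rw [O.cf_mono]; split_ifs
      · exact ha
      · exact p.zero_mem
    · intro k hk; rw [O.cf_mono, if_neg (by omega)]; exact p.zero_mem
    · rw [O.cf_mono, if_pos rfl]
  -- minimal degree
  have hex : ∃ m, ∃ g ∈ J, g ∉ O.pSet p ∧ O.dg p m g := by
    obtain ⟨g, hg, hgp⟩ := Set.not_subset.1 hne
    obtain ⟨n, hn⟩ := O.exists_bound g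
    exact ⟨n, g, hg, hgp, fun k hk => by rw [hn k hk]; exact p.zero_mem⟩
  obtain ⟨m, ⟨g0, hg0J, hg0p, hg0d⟩, hmin⟩ :
      ∃ m, (∃ g ∈ J, g ∉ O.pSet p ∧ O.dg p m g) ∧
        ∀ n < m, ¬ ∃ g ∈ J, g ∉ O.pSet p ∧ O.dg p n g :=
    ⟨Nat.find hex, Nat.find_spec hex, fun n hn => Nat.find_min hex hn⟩
  have hlow : ∀ g ∈ J, O.dg p m g → O.cf m g ∈ p → g ∈ O.pSet p := by
    intro g hg hgd hgm
    by_contra hcon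
    have hall : ∀ k, m ≤ k → O.cf k g ∈ p := by
      intro k hk
      rcases hk.eq_or_lt with rfl | h
      · exact hgm
      · exact hgd k h
    cases m with
    | zero => exact hcon (O.mem_pSet.2 fun k => hall k (Nat.zero_le k))
    | succ m => exact hmin m (Nat.lt_succ_self m) ⟨g, hg, hcon, fun k hk => hall k hk⟩
  have hLp : ¬ leadI O p hJ m ≤ p := fun h => hg0p (hlow g0 hg0J hg0d (h ⟨g0, hg0J, hg0d, rfl⟩))
  rcases dichotomy hleib hadd hp0 hp with hA | hB
  · -- case A : union of all leading ideals
    have hmono : Monotone (leadI O p hJ) := by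
      refine monotone_nat_of_le_succ ?_
      rintro n _ ⟨g, hg, hgd, rfl⟩
      refine ⟨g * O.x, hJ.2.2.2 _ _ hg, ?_, O.cf_mulx_succ _ _⟩
      intro k hk
      obtain ⟨j, rfl⟩ : ∃ j', k = j' + 1 := ⟨k - 1, by omega⟩
      rw [O.cf_mulx_succ]; exact hgd _ (by omega)
    obtain ⟨N, hN⟩ := monotone_stabilizes_iff_noetherian.2 (inferInstance : IsNoetherian D D)
      ⟨leadI O p hJ, hmono⟩
    have hN' : ∀ n, N ≤ n → leadI O p hJ N = leadI O p hJ n := hN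
    have hsig : ∀ a ∈ leadI O p hJ N, σ a ∈ leadI O p hJ N := by
      rintro _ ⟨g, hg, hgd, rfl⟩
      rw [hN' (N+1) (by omega)]
      have hx := O.xpow_dg hadd hs hd hgd 1
      have h1 : O.cf (N+1) (O.x ^ 1 * g) ∈ leadI O p hJ (N+1) :=
        ⟨O.x ^ 1 * g, hJ.2.2.1 _ _ hg, hx.1, rfl⟩
      have h2 := (leadI O p hJ (N+1)).sub_mem h1 (hpL _ hx.2)
      simpa using h2
    refine ⟨leadI O p hJ N, ⟨hsig, hA _ (hpL N) hsig⟩, ?_, fun b hb => ⟨N, hb⟩⟩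
    intro h
    apply hLp
    refine le_trans ?_ h
    rcases le_total m N with h' | h'
    · exact hmono h'
    · exact (hN' m h').symm.le
  · -- case B : minimal degree
    set L := leadI O p hJ m with hLdef
    have hL0 : L ≠ ⊥ := fun h => hLp (h ▸ bot_le)
    have hcoef : ∀ g ∈ J, O.dg p m g → ∀ k, O.cf k g ∈ L := by
      intro g hg hgd k
      obtain ⟨M, hM⟩ := Ideal.dvd_iff_le.2 (hpL m)
      have hM0 : M ≠ ⊥ := by
        rintro rfl
        apply hp0; rw [hM]; simp
      have h1 : ∀ c ∈ M, c * O.cf k g ∈ p := by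
        intro c hc
        have hmem : O.i c * g ∈ O.pSet p := by
          apply hlow _ (hJ.2.2.1 _ _ hg)
          · intro j hj; rw [O.cf_imul]; exact p.mul_mem_left _ (hgd j hj)
          · rw [O.cf_imul, hM, mul_comm c]
            exact Ideal.mul_mem_mul ⟨g, hg, hgd, rfl⟩ hc
        have := O.mem_pSet.1 hmem k
        rwa [O.cf_imul] at this
      have h2 : Ideal.span {O.cf k g} * M ≤ L * M := by
        rw [Ideal.span_singleton_mul_le_iff]
        intro c hc
        rw [hLdef, ← hM, mul_comm]; exact h1 c hc
      have h3 : L ∣ Ideal.span {O.cf k g} := by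
        have := Ideal.dvd_iff_le.2 h2
        exact (mul_dvd_mul_iff_right hM0).1 this
      rwa [Ideal.dvd_span_singleton] at h3
    refine ⟨L, ⟨hB L (hpL m), ?_⟩, hLp, fun b hb => ⟨m, hb⟩⟩
    rintro _ ⟨g, hg, hgd, rfl⟩
    obtain ⟨g', hg', hgd', hlead⟩ : σ (O.cf m g) ∈ L := hB L (hpL m) _ ⟨g, hg, hgd, rfl⟩
    have hmem : O.cf m (O.x * g - g' * O.x) ∈ L := by
      refine ⟨O.x * g - g' * O.x, ts_sub hJ (hJ.2.2.1 _ _ hg) (hJ.2.2.2 _ _ hg'), ?_, rfl⟩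
      intro k hk
      obtain ⟨j, rfl⟩ : ∃ j', k = j' + 1 := ⟨k - 1, by omega⟩
      rw [O.cf_sub, O.cf_xmul_succ hadd, O.cf_mulx_succ]
      have hdj := hd _ (hgd (j+1) hk)
      rcases (Nat.lt_succ_iff.1 hk).eq_or_lt with h | h
      · subst h
        rw [hlead]
        simpa using hdj
      · exact p.sub_mem (p.add_mem (hs _ (hgd j h)) hdj) (hgd' j h)
    clear_value L
    cases m with
    | zero =>
      rw [O.cf_sub, O.cf_xmul_zero hadd, O.cf_mulx_zero, sub_zero] at hmem
      exact hmem
    | succ n =>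
      rw [O.cf_sub, O.cf_xmul_succ hadd, O.cf_mulx_succ] at hmem
      have h1 : σ (O.cf n g) ∈ L := by
        rw [hLdef] at hcoef ⊢
        exact hB _ (hpL _) _ (hcoef g hg hgd n)
      have h2 := hcoef g' hg' hgd' n
      have := L.add_mem (L.sub_mem hmem h1) h2
      convert this using 1
      simp only [RingEquiv.coe_toRingHom, RingHom.coe_coe]
      ring

lemma pSet_prime {σ : D ≃+* D} {δ : D → D}
    (hleib : ∀ a b : D, δ (a * b) = σ a * δ b + δ a * b)
    (hadd : ∀ a b : D, δ (a + b) = δ a + δ b)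
    (O : OreData D R (σ : D →+* D) δ)
    {p : Ideal D} (hp0 : p ≠ ⊥) (hp : SDPrime σ δ p) : IsPrimeTS (O.pSet p) := by
  classical
  have hs : ∀ a ∈ p, (σ : D →+* D) a ∈ p := hp.2.1.1
  have hd : ∀ a ∈ p, δ a ∈ p := hp.2.1.2
  have hP := O.pSet_ideal hadd hs hd
  refine ⟨hP, ?_, ?_⟩
  · intro h
    have h1 : O.i 1 * O.x ^ 0 ∈ O.pSet p := by rw [h]; trivial
    have := O.mem_pSet.1 h1 0
    rw [O.cf_mono, if_pos rfl] at this
    exact hp.1 ((Ideal.eq_top_iff_one _).2 this)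
  · intro f g hfg
    by_contra hcon
    push Not at hcon
    obtain ⟨hf, hg⟩ := hcon
    let J : Set R := {g | ∀ r, f * r * g ∈ O.pSet p}
    have hJ : IsTwoSidedIdealSet J := by
      refine ⟨?_, ?_, ?_, ?_⟩
      · intro r; rw [mul_zero]; exact hP.1
      · intro a b ha hb r; rw [mul_add]; exact hP.2.1 _ _ (ha r) (hb r)
      · intro r a ha r'
        have := ha (r' * r)
        simpa [mul_assoc] using this
      · intro r a ha r'
        rw [← mul_assoc]; exact hP.2.2.2 _ _ (ha r')
    have hPJ : O.pSet p ⊆ J := fun a ha r => hP.2.2.1 _ _ ha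
    obtain ⟨X, hX, hXp, hXl⟩ := exists_lead hleib hadd O hp0 hp hJ hPJ (fun h => hg (h hfg))
    -- top coefficient of f outside p
    have hexf : ∃ n, O.dg p n f ∧ O.cf n f ∉ p := by
      by_contra hno
      push Not at hno
      apply hf
      obtain ⟨N, hN⟩ := O.exists_bound f
      have hN' : O.dg p N f := fun k hk => by rw [hN k hk]; exact p.zero_mem
      have : ∀ n, n ≤ N → O.dg p (N - n) f := by
        intro n
        induction n with
        | zero => intro _; exact hN'
        | succ n ih =>
          intro hn k hk
          have h1 := ih (by omega)
          rcases (show N - n ≤ k by omega).eq_or_lt with h | h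
          · subst h; exact hno _ h1
          · exact h1 k h
      have h0 : O.dg p 0 f := by simpa using this N le_rfl
      rw [O.mem_pSet]
      intro k
      rcases Nat.eq_zero_or_pos k with rfl | h
      · exact hno 0 h0
      · exact h0 k h
    obtain ⟨n, hfd, hfn⟩ := hexf
    apply hfn
    apply colon_le hleib hadd hp hX hXp
    have hsym : ∀ k : ℕ, ∀ b ∈ X, σ.symm^[k] b ∈ X := by
      intro k
      induction k with
      | zero => simp
      | succ k ih => intro b hb; rw [Function.iterate_succ_apply]
                     exact ih _ (symm_mem_of_stable σ hX.1 hb)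
    intro b hb
    obtain ⟨m, g', hg', hgd', he⟩ := hXl _ (hsym n b hb)
    have h1 := hg' 1
    rw [mul_one] at h1
    have h2 := O.mul_top hadd hs hd hfd hgd' h1
    rw [he] at h2
    have h3 : σ^[n] (σ.symm^[n] b) = b :=
      Function.RightInverse.iterate (f := σ) (g := σ.symm) (fun a => by simp) n _
    change O.cf n f * σ^[n] (σ.symm^[n] b) ∈ p at h2
    rwa [h3] at h2

lemma prime_sub {σ : D ≃+* D} {δ : D → D}
    (O : OreData D R (σ : D →+* D) δ)
    {p : Ideal D} (hp0 : p ≠ ⊥) (hp : SDPrime σ δ p) {Q : Set R} (hQ : IsPrimeTS Q)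
    (hQ0 : Q ≠ {0}) (hQP : Q ⊆ O.pSet p) : O.pSet p ⊆ Q := by
  classical
  have hQi := hQ.1
  have hs : ∀ a ∈ p, (σ : D →+* D) a ∈ p := hp.2.1.1
  have hd : ∀ a ∈ p, δ a ∈ p := hp.2.1.2
  by_cases hpQ : ∀ a ∈ p, O.i a ∈ Q
  · intro f hf
    rw [O.eq_sum f]
    exact ts_sum hQi _ _ fun k _ => hQi.2.2.2 _ _ (hpQ _ (O.mem_pSet.1 hf k))
  exfalso
  push Not at hpQ
  obtain ⟨a0, ha0, ha0Q⟩ := hpQ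
  have hx : ∀ g : R, (∀ a ∈ p, O.i a * g ∈ Q) → ∀ a ∈ p, O.i a * (O.x * g) ∈ Q := by
    intro g hg a ha
    have hb := symm_mem_of_stable σ hp.2.1.1 ha
    have h1 := O.comm (σ.symm a)
    have h2 : O.i a * (O.x * g) = O.x * (O.i (σ.symm a) * g) - O.i (δ (σ.symm a)) * g := by
      rw [← mul_assoc, ← mul_assoc, h1]
      simp [add_mul]
    rw [h2]
    exact ts_sub hQi (hQi.2.2.1 _ _ (hg _ hb)) (hg _ (hd _ hb))
  have hxn : ∀ (n : ℕ) (g : R), (∀ a ∈ p, O.i a * g ∈ Q) → ∀ a ∈ p, O.i a * (O.x ^ n * g) ∈ Q := by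
    intro n
    induction n with
    | zero => intro g hg; simpa using hg
    | succ n ih => intro g hg; rw [pow_succ', mul_assoc]; exact hx _ (ih g hg)
  have hcolon : ∀ g : R, (∀ a ∈ p, O.i a * g ∈ Q) → g ∈ Q := by
    intro g hg
    refine (hQ.2.2 (O.i a0) g ?_).resolve_left ha0Q
    intro r
    rw [mul_assoc, O.mul_eq_sum r g, Finset.mul_sum]
    refine ts_sum hQi _ _ fun k _ => ?_
    rw [← mul_assoc, ← map_mul]
    exact hxn k g hg _ (p.mul_mem_right _ ha0)
  -- choose a nonzero element
  obtain ⟨a, ha, ha'⟩ := Submodule.exists_mem_ne_zero_of_ne_bot hp0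
  obtain ⟨M, hM⟩ := (Ideal.dvd_span_singleton (I := p)).2 ha
  have hM0 : M ≠ ⊥ := by
    rintro rfl
    apply ha'
    rw [Ideal.mul_bot, Ideal.span_singleton_eq_bot] at hM
    exact hM
  have hpow : ∀ n : ℕ, ∀ f ∈ Q, ∀ k, O.cf k f ∈ p ^ n := by
    intro n
    induction n with
    | zero => intro f _ k; simp
    | succ n ih =>
      intro f hf k
      have hfp := O.mem_pSet.1 (hQP hf)
      have h1 : ∀ j ∈ M, j * O.cf k f ∈ Ideal.span {a} * p ^ n := by
        intro j hj
        have hdiv : ∀ l, ∃ d, j * O.cf l f = a * d := by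
          intro l
          have : j * O.cf l f ∈ Ideal.span {a} := by
            rw [hM, mul_comm j]; exact Ideal.mul_mem_mul (hfp l) hj
          exact Ideal.mem_span_singleton.1 this
        choose dd hdd using hdiv
        let g : R := ∑ l ∈ (O.ph f).support, O.i (dd l) * O.x ^ l
        have hg : O.i j * f = O.i a * g := by
          conv_lhs => rw [O.eq_sum f]
          rw [Finset.mul_sum, Finset.mul_sum]
          refine Finset.sum_congr rfl fun l _ => ?_
          rw [← mul_assoc, ← mul_assoc, ← map_mul, ← map_mul, hdd]
        have hgQ : g ∈ Q := by
          apply hcolon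
          intro b hb
          have : b * j ∈ Ideal.span {a} := by rw [hM]; exact Ideal.mul_mem_mul hb hj
          obtain ⟨d, hd'⟩ := Ideal.mem_span_singleton.1 this
          have h2 : O.i b * g = O.i d * f := by
            apply O.cf_ext
            intro l
            have h3 := congrArg (O.cf l) hg
            rw [O.cf_imul, O.cf_imul] at h3
            rw [O.cf_imul, O.cf_imul]
            apply mul_left_cancel₀ ha'
            linear_combination O.cf l f * hd' - b * h3
          rw [h2]; exact hQi.2.2.1 _ _ hf
        have h3 := congrArg (O.cf k) hg
        rw [O.cf_imul, O.cf_imul] at h3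
        rw [h3]
        exact Ideal.mul_mem_mul (Ideal.mem_span_singleton_self a) (ih g hgQ k)
      have h2 : Ideal.span {O.cf k f} * M ≤ p ^ (n+1) * M := by
        rw [Ideal.span_singleton_mul_le_iff]
        intro j hj
        have := h1 j hj
        rw [hM] at this
        rw [mul_comm (O.cf k f)]
        convert this using 1
        ring
      have h3 : p ^ (n+1) ∣ Ideal.span {O.cf k f} :=
        (mul_dvd_mul_iff_right hM0).1 (Ideal.dvd_iff_le.2 h2)
      rwa [Ideal.dvd_span_singleton] at h3
  apply hQ0
  ext f
  constructor
  · intro hf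
    apply O.cf_ext
    intro k
    rw [O.cf_zero]
    have h1 : O.cf k f ∈ ⨅ n : ℕ, p ^ n := by
      rw [Ideal.mem_iInf]; exact fun n => hpow n f hf k
    rw [Ideal.iInf_pow_eq_bot_of_isDomain p hp.1] at h1
    exact h1
  · rintro rfl; exact hQi.1

end main

/-- If `𝔭` is a minimal `(σ, δ)`-prime ideal of `D` and `P = 𝔭[x; σ, δ]`, then
`P` is a minimal prime ideal of `R`. -/
theorem stmt8 {D R : Type*} [CommRing D] [IsDomain D] [IsDedekindDomain D] [Ring R]
    (σ : D ≃+* D) (hσ : (⇑σ : D → D) ≠ id) (δ : D → D) (hδ0 : δ ≠ 0)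
    (hadd : ∀ a b : D, δ (a + b) = δ a + δ b)
    (hleib : ∀ a b : D, δ (a * b) = σ a * δ b + δ a * b)
    (O : OreData D R (σ : D →+* D) δ)
    (𝔭 : Ideal D) (h𝔭 : MinSDPrime (⇑σ) δ 𝔭) :
    MinimalPrimeTS (O.pSet 𝔭) := by

  have hprime := pSet_prime hleib hadd O h𝔭.1 h𝔭.2.1
  refine ⟨hprime, ?_, ?_⟩
  · intro h
    obtain ⟨a, ha, ha'⟩ := Submodule.exists_mem_ne_zero_of_ne_bot h𝔭.1
    have h1 : O.i a * O.x ^ 0 ∈ O.pSet 𝔭 := by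
      rw [O.mem_pSet]; intro k; rw [O.cf_mono]; split_ifs
      · exact ha
      · exact Ideal.zero_mem _
    rw [h, Set.mem_singleton_iff] at h1
    have h2 := O.cf_mono 0 0 a
    rw [h1, O.cf_zero, if_pos rfl] at h2
    exact ha' h2.symm
  · intro Q hQ hQ0 hQP
    exact Set.Subset.antisymm hQP (prime_sub O h𝔭.1 h𝔭.2.1 hQ hQ0 hQP)
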